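/- Let $G$ be a graph on $n \geq 2k+3$ vertices, $k \geq 2$, with minimum degree $\delta(G) \geq k+1$ and with a cut-vertex or disconnected, such that every even cycle of $G$ has length at most $2k$. If $G$ is 2-connected, then $G$ contains an even cycle of length at least $2k+2$ — i.e., no 2-connected graph on at least $2k+1$ vertices with minimum degree at least $k \geq 3$ has all its even cycles of length at most $2k$. -/

import Mathlib

open SimpleGraph

attribute [local instance] Classical.propDecidable

/-- `G` is 2-connected: at least 3 vertices and deleting any vertex leaves a
connected graph. -/
def TwoConnected {V : Type*} [Fintype V] (G : SimpleGraph V) : Prop :=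
  3 ≤ Fintype.card V ∧ ∀ v : V, (G.induce {w | w ≠ v}).Connected
/-! Path lists and cycle lists. -/

def PL {V : Type*} (G : SimpleGraph V) (l : List V) (a b : V) : Prop :=
  l.Nodup ∧ l.IsChain G.Adj ∧ l.head? = some a ∧ l.getLast? = some b

def CL {V : Type*} (G : SimpleGraph V) (l : List V) : Prop :=
  3 ≤ l.length ∧ ∃ a b, PL G l a b ∧ G.Adj b a

theorem PL.single {V : Type*} {G : SimpleGraph V} (a : V) : PL G [a] a a := by
  simp [PL]

theorem PL.append {V : Type*} {G : SimpleGraph V} {l₁ l₂ : List V} {a b c d : V}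
    (h₁ : PL G l₁ a b) (h₂ : PL G l₂ c d) (hbc : G.Adj b c)
    (hd : ∀ v ∈ l₁, v ∉ l₂) : PL G (l₁ ++ l₂) a d := by
  obtain ⟨n1, c1, x1, y1⟩ := h₁
  obtain ⟨n2, c2, x2, y2⟩ := h₂
  refine ⟨List.nodup_append.2 ⟨n1, n2, ?_⟩, c1.append c2 ?_, ?_, ?_⟩
  · intro v hv w hw h
    exact hd v hv (h ▸ hw)
  · intro x hx y hy
    rw [y1] at hx; rw [x2] at hy
    simp only [Option.mem_def, Option.some.injEq] at hx hy
    subst hx; subst hy; exact hbc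
  · simp [List.head?_append, x1]
  · simp [List.getLast?_append, y2]

theorem PL.reverse {V : Type*} {G : SimpleGraph V} {l : List V} {a b : V}
    (h : PL G l a b) : PL G l.reverse b a := by
  obtain ⟨n1, c1, x1, y1⟩ := h
  refine ⟨List.nodup_reverse.2 n1, List.isChain_reverse.2 ?_, by simpa using y1, by simpa using x1⟩
  exact c1.imp fun _ _ h => h.symm

theorem PL.head_mem {V : Type*} {G : SimpleGraph V} {l : List V} {a b : V}
    (h : PL G l a b) : a ∈ l := List.mem_of_mem_head? h.2.2.1

theorem PL.last_mem {V : Type*} {G : SimpleGraph V} {l : List V} {a b : V}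
    (h : PL G l a b) : b ∈ l := List.mem_of_mem_getLast? h.2.2.2

theorem PL.seg {V : Type*} {G : SimpleGraph V} {h : ℕ → V} {m : ℕ}
    (hinj : ∀ i j, i < m → j < m → h i = h j → i = j)
    (hadj : ∀ i, G.Adj (h i) (h (i + 1))) {s n : ℕ} (hn : 1 ≤ n) (hs : s + n ≤ m) :
    PL G ((List.range' s n).map h) (h s) (h (s + n - 1)) := by
  refine ⟨?_, ?_, ?_, ?_⟩
  · refine List.Nodup.map_on ?_ (List.nodup_range')
    intro x hx y hy hxy
    simp only [List.mem_range'_1] at hx hy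
    exact hinj x y (by omega) (by omega) hxy
  · rw [List.isChain_map]
    refine (List.isChain_range' s n 1).imp ?_
    rintro a b rfl
    exact hadj a
  · rw [List.head?_map, List.head?_range']
    simp; omega
  · rw [List.getLast?_map, List.getLast?_range']
    simp; omega

theorem mem_seg {V : Type*} {h : ℕ → V} {s n : ℕ} {v : V} :
    v ∈ (List.range' s n).map h ↔ ∃ i, s ≤ i ∧ i < s + n ∧ h i = v := by
  simp [List.mem_range'_1, and_assoc]

/-- a cycle list gives a cycle walk -/
theorem CL.toWalk {V : Type*} {G : SimpleGraph V} {l : List V} (h : CL G l) :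
    ∃ (v : V) (c : G.Walk v v), c.IsCycle ∧ c.length = l.length := by
  obtain ⟨h3, a, b, ⟨hn, hc, ha, hb⟩, hab⟩ := h
  have hne : l ≠ [] := by rintro rfl; simp at h3
  have ha' : l.head hne = a := by
    rw [List.head?_eq_some_head hne] at ha; simpa using ha
  have hb' : l.getLast hne = b := by
    rw [List.getLast?_eq_some_getLast hne] at hb; simpa using hb
  let p := (Walk.ofSupport l hne hc).copy ha' hb'
  have hps : p.support = l := by simp [p]
  have hpl : p.length = l.length - 1 := by simp [p]
  have hpp : p.IsPath := by rw [Walk.isPath_def, hps]; exact hn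
  refine ⟨b, Walk.cons hab p, (Walk.cons_isCycle_iff _ _).2 ⟨hpp, ?_⟩, ?_⟩
  · intro he
    have := hpp.length_eq_one_of_mem_edges (by simpa [Sym2.eq_swap] using he)
    omega
  · rw [Walk.length_cons, hpl]; omega

/-- a cycle walk gives a cycle list -/
theorem CL.ofWalk {V : Type*} {G : SimpleGraph V} {v : V} {c : G.Walk v v} (h : c.IsCycle) :
    ∃ l, CL G l ∧ l.length = c.length := by
  cases c with
  | nil => simp at h
  | cons hadj p =>
    rename_i w
    have h3 := h.three_le_length
    rw [Walk.cons_isCycle_iff] at h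
    refine ⟨p.support, ⟨by simpa using h3, w, v, ⟨h.1.support_nodup, p.isChain_adj_support, ?_, ?_⟩, hadj⟩, ?_⟩
    · rw [List.head?_eq_some_head p.support_ne_nil]; simp
    · rw [List.getLast?_eq_some_getLast p.support_ne_nil]; simp
    · simp

/-- a cycle list as an injective cyclic function -/
theorem CL.toFun {V : Type*} {G : SimpleGraph V} {l : List V} (h : CL G l) {m : ℕ} (hm : l.length = m) :
    ∃ g : ZMod m → V, Function.Injective g ∧ (∀ i, G.Adj (g i) (g (i + 1))) ∧
      ∀ v, v ∈ l ↔ ∃ i, g i = v := by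
  obtain ⟨h3, a, b, ⟨hn, hc, ha, hb⟩, hab⟩ := h
  have : NeZero m := ⟨by omega⟩
  have hlt : ∀ i : ZMod m, i.val < l.length := fun i => hm ▸ ZMod.val_lt i
  refine ⟨fun i => l[i.val]'(hlt i), ?_, ?_, ?_⟩
  · intro i j hij
    exact ZMod.val_injective m ((hn.getElem_inj_iff).1 hij)
  · intro i
    by_cases hi : i.val + 1 < m
    · have : (i + 1).val = i.val + 1 := by
        rw [ZMod.val_add, ZMod.val_one'' (by omega), Nat.mod_eq_of_lt hi]
      simp only [this]
      exact List.isChain_iff_getElem.1 hc _ (by omega)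
    · have hi' := ZMod.val_lt i
      have h1 : (i + 1).val = 0 := by
        rw [ZMod.val_add, ZMod.val_one'' (by omega), show i.val + 1 = m by omega, Nat.mod_self]
      simp only [h1]
      have ha' : l[0]'(by omega) = a := by
        rw [List.head?_eq_getElem?, List.getElem?_eq_getElem (by omega)] at ha; simpa using ha
      have hb' : l[i.val]'(hlt i) = b := by
        rw [List.getLast?_eq_getElem?, List.getElem?_eq_getElem (by omega)] at hb
        have : l.length - 1 = i.val := by omega
        simpa [this] using hb
      rw [ha', hb']; exact hab
  · intro v
    rw [List.mem_iff_getElem]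
    constructor
    · rintro ⟨i, hi, rfl⟩
      refine ⟨(i : ZMod m), ?_⟩
      simp [ZMod.val_natCast, Nat.mod_eq_of_lt (hm ▸ hi)]
    · rintro ⟨i, rfl⟩
      exact ⟨i.val, hlt i, rfl⟩
/-! Explicit cycles. -/

section explicit
variable {V : Type*} {G : SimpleGraph V} {h : ℕ → V} {m : ℕ}

theorem cyc_T1 (hinj : ∀ i j, i < m → j < m → h i = h j → i = j)
    (hadj : ∀ i, G.Adj (h i) (h (i + 1))) {a b : ℕ} (ha : 1 ≤ a) (hb : 1 ≤ b)
    (hab : a + b ≤ m) (h3 : 3 ≤ a + b) (e1 : G.Adj (h (b - 1)) (h (b + a - 1)))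
    (e2 : G.Adj (h b) (h 0)) : ∃ l, CL G l ∧ l.length = a + b := by
  have p1 := PL.seg hinj hadj (s := 0) (n := b) hb (by omega)
  have p2 := (PL.seg hinj hadj (s := b) (n := a) ha (by omega)).reverse
  have p := p1.append p2 (by simpa using e1) (by
    intro v hv hv2
    rw [List.mem_reverse] at hv2
    rw [mem_seg] at hv hv2
    obtain ⟨i, _, _, rfl⟩ := hv
    obtain ⟨j, _, _, hj⟩ := hv2
    have := hinj j i (by omega) (by omega) hj
    omega)
  exact ⟨_, ⟨by simp; omega, _, _, p, e2⟩, by simp; omega⟩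

theorem cyc_T2 (hinj : ∀ i j, i < m → j < m → h i = h j → i = j)
    (hadj : ∀ i, G.Adj (h i) (h (i + 1))) {a b : ℕ} (ha : 3 ≤ a) (hb : 1 ≤ b)
    (hab : a + b + 2 ≤ m) (e1 : G.Adj (h (b - 1)) (h (b + a - 1)))
    (e2 : G.Adj (h (b + a + 1)) (h (b + a - 2)))
    (e3 : G.Adj (h b) (h 0)) : ∃ l, CL G l ∧ l.length = a + b + 2 := by
  have p1 := PL.seg hinj hadj (s := 0) (n := b) hb (by omega)
  have p2 := PL.seg hinj hadj (s := b + a - 1) (n := 3) (by omega) (by omega)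
  have p3 := (PL.seg hinj hadj (s := b) (n := a - 1) (by omega) (by omega)).reverse
  have p12 := p1.append p2 (by simpa using e1) (by
    intro v hv hv2
    rw [mem_seg] at hv hv2
    obtain ⟨i, _, _, rfl⟩ := hv
    obtain ⟨j, _, _, hj⟩ := hv2
    have := hinj j i (by omega) (by omega) hj
    omega)
  have p := p12.append p3 (by
      convert e2 using 2 <;> omega) (by
    intro v hv hv2
    rw [List.mem_reverse] at hv2
    rw [List.mem_append, mem_seg, mem_seg] at hv
    rw [mem_seg] at hv2
    obtain ⟨j, _, _, rfl⟩ := hv2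
    rcases hv with ⟨i, _, _, hj⟩ | ⟨i, _, _, hj⟩
    · have := hinj i j (by omega) (by omega) hj
      omega
    · have := hinj i j (by omega) (by omega) hj
      omega)
  exact ⟨_, ⟨by simp; omega, _, _, p, e3⟩, by simp; omega⟩

theorem cyc_T3 (hinj : ∀ i j, i < m → j < m → h i = h j → i = j)
    (hadj : ∀ i, G.Adj (h i) (h (i + 1))) {K : ℕ} (hK : 3 ≤ K) (hm : 2 * K + 1 ≤ m)
    (e1 : G.Adj (h 2) (h (2 * K - 1))) (e2 : G.Adj (h (2 * K)) (h 3))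
    (e3 : G.Adj (h (2 * K - 3)) (h 0)) : ∃ l, CL G l ∧ l.length = 2 * K := by
  have p1 := PL.seg hinj hadj (s := 0) (n := 3) (by omega) (by omega)
  have p2 := PL.seg hinj hadj (s := 2 * K - 1) (n := 2) (by omega) (by omega)
  have p3 := PL.seg hinj hadj (s := 3) (n := 2 * K - 5) (by omega) (by omega)
  have p12 := p1.append p2 (by simpa using e1) (by
    intro v hv hv2
    rw [mem_seg] at hv hv2
    obtain ⟨i, _, _, rfl⟩ := hv
    obtain ⟨j, _, _, hj⟩ := hv2
    have := hinj j i (by omega) (by omega) hj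
    omega)
  have p := p12.append p3 (by
      convert e2 using 2; omega) (by
    intro v hv hv2
    rw [List.mem_append, mem_seg, mem_seg] at hv
    rw [mem_seg] at hv2
    obtain ⟨j, _, _, rfl⟩ := hv2
    rcases hv with ⟨i, _, _, hj⟩ | ⟨i, _, _, hj⟩
    · have := hinj i j (by omega) (by omega) hj
      omega
    · have := hinj i j (by omega) (by omega) hj
      omega)
  exact ⟨_, ⟨by simp, _, _, p, by convert e3 using 2; omega⟩, by simp; omega⟩

/-- arc `h s, ..., h (s+n-1)` closed by a path `l` outside. -/
theorem cyc_ear (hinj : ∀ i j, i < m → j < m → h i = h j → i = j)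
    (hadj : ∀ i, G.Adj (h i) (h (i + 1))) {s n : ℕ} (hn : 1 ≤ n) (hs : s + n ≤ m)
    {l : List V} {a b : V} (hl : PL G l a b) (hd : ∀ i, h i ∉ l)
    (e1 : G.Adj (h (s + n - 1)) a) (e2 : G.Adj b (h s)) (h3 : 3 ≤ n + l.length) :
    ∃ l', CL G l' ∧ l'.length = n + l.length := by
  have p := (PL.seg hinj hadj hn hs).append hl e1 (by
    intro v hv
    rw [mem_seg] at hv
    obtain ⟨i, _, _, rfl⟩ := hv
    exact hd i)
  exact ⟨_, ⟨by simpa using h3, _, _, p, e2⟩, by simp⟩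
end explicit
/-! Arithmetic of attachments. -/

theorem card_gap (X : Finset ℕ) (hgap : ∀ a ∈ X, ∀ b ∈ X, a < b → a + 2 ≤ b) (hi : ℕ) :
    ∀ lo, (∀ a ∈ X, lo ≤ a ∧ a ≤ hi) → X.Nonempty → 2 * X.card + lo ≤ hi + 2 := by
  induction X using Finset.induction_on_min with
  | empty => simp
  | insert a s hs ih =>
    intro lo hlo _
    have ha : a ∉ s := fun h => lt_irrefl _ (hs a h)
    rw [Finset.card_insert_of_notMem ha]
    have h1 := hlo a (Finset.mem_insert_self _ _)
    by_cases hne : s.Nonempty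
    · have := ih (fun x hx y hy => hgap x (Finset.mem_insert_of_mem hx) y (Finset.mem_insert_of_mem hy))
        (a + 2) (fun x hx => ⟨hgap a (Finset.mem_insert_self _ _) x (Finset.mem_insert_of_mem hx) (hs x hx),
          (hlo x (Finset.mem_insert_of_mem hx)).2⟩) hne
      omega
    · rw [Finset.not_nonempty_iff_eq_empty] at hne
      subst hne
      simp; omega

theorem ear_arith (X : Finset ℕ) (hX : X.Nonempty) (m q K : ℕ)
    (h1 : ∀ D ∈ X, q ≤ D ∧ D + q ≤ m)
    (h2 : ∀ D ∈ X, Even (D + q) → D + q + 2 ≤ 2 * K)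
    (h2' : ∀ D ∈ X, Even (m - D + q) → m - D + q + 2 ≤ 2 * K)
    (h3 : ∀ D ∈ X, ∀ D' ∈ X, D < D' → D + 2 ≤ D')
    (h4 : ∀ D ∈ X, ∀ D' ∈ X, D < D' → Even (m - (D' - D) + 2) → m - (D' - D) + 4 ≤ 2 * K)
    (h5 : Even m → m + 2 ≤ 2 * K) : X.card + q ≤ K := by
  by_cases hm : Even m
  · have := card_gap X h3 (m - q) q (fun a ha => by have := h1 a ha; omega) hX
    have := h5 hm
    obtain ⟨x, hx⟩ := hX
    have := h1 x hx
    omega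
  rw [Nat.not_even_iff_odd] at hm
  have hmx := X.max'_mem hX
  have hmn := X.min'_mem hX
  by_cases hr : Even (X.max' hX + q)
  · have := card_gap X h3 (X.max' hX) q (fun a ha => ⟨(h1 a ha).1, X.le_max' a ha⟩) hX
    have := h2 _ hmx hr
    omega
  by_cases hl : Even (X.min' hX + q)
  swap
  · have := card_gap X h3 (m - q) (X.min' hX) (fun a ha => ⟨X.min'_le a ha, by have := h1 a ha; omega⟩) hX
    have h1' := h1 _ hmn
    have := h2' _ hmn (by grind)
    omega
  · let T := X.filter (fun D => ¬ Even (D + q))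
    have hT : T.Nonempty := ⟨_, Finset.mem_filter.2 ⟨hmx, hr⟩⟩
    have hj := T.min'_mem hT
    set j := T.min' hT with hjdef
    obtain ⟨hjX, hjp⟩ := Finset.mem_filter.1 hj
    let L := X.filter (fun D => D < j)
    have hjm : X.min' hX < j := by
      refine lt_of_le_of_ne (X.min'_le _ hjX) ?_
      intro h; rw [h] at hl; exact hjp hl
    have hL : L.Nonempty := ⟨_, Finset.mem_filter.2 ⟨hmn, hjm⟩⟩
    have hi := L.max'_mem hL
    set i := L.max' hL with hidef
    obtain ⟨hiX, hij⟩ := Finset.mem_filter.1 hi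
    have hip : Even (i + q) := by
      by_contra hcon
      have := T.min'_le i (Finset.mem_filter.2 ⟨hiX, hcon⟩)
      omega
    let R := X.filter (fun D => ¬ D < j)
    have hcard : L.card + R.card = X.card := Finset.card_filter_add_card_filter_not _
    have hLX : ∀ a ∈ L, a ∈ X := fun a ha => (Finset.mem_filter.1 ha).1
    have hRX : ∀ a ∈ R, a ∈ X := fun a ha => (Finset.mem_filter.1 ha).1
    have c1 := card_gap L (fun a ha b hb => h3 a (hLX a ha) b (hLX b hb)) i q
      (fun a ha => ⟨(h1 a (hLX a ha)).1, L.le_max' a ha⟩) hL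
    have c2 := card_gap R (fun a ha b hb => h3 a (hRX a ha) b (hRX b hb)) (m - q) j
      (fun a ha => ⟨not_lt.1 (Finset.mem_filter.1 ha).2, by have := h1 a (hRX a ha); omega⟩)
      ⟨j, Finset.mem_filter.2 ⟨hjX, lt_irrefl _⟩⟩
    have h1i := h1 i hiX
    have h1j := h1 j hjX
    have := h4 i hiX j hjX hij (by grind)
    omega
/-! The Hamiltonian case. -/

section ham
variable {V : Type*} {G : SimpleGraph V} {m K : ℕ} {g : ZMod m → V}

theorem base_inj (hinj : Function.Injective g) (z : ZMod m) :
    ∀ i j : ℕ, i < m → j < m → g (z + (i : ZMod m)) = g (z + (j : ZMod m)) → i = j := by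
  intro i j hi hj h
  have h1 := add_left_cancel (hinj h)
  rw [ZMod.natCast_eq_natCast_iff] at h1
  exact Nat.ModEq.eq_of_lt_of_lt h1 hi hj

theorem base_adj (hadj : ∀ i, G.Adj (g i) (g (i + 1))) (z : ZMod m) :
    ∀ i : ℕ, G.Adj (g (z + (i : ZMod m))) (g (z + ((i + 1 : ℕ) : ZMod m))) := by
  intro i
  have := hadj (z + i)
  push_cast
  rwa [← add_assoc]

theorem ham_T1 (hinj : Function.Injective g) (hadj : ∀ i, G.Adj (g i) (g (i + 1)))
    (hno : ∀ l, CL G l → Even l.length → l.length < 2 * K) (hK : 3 ≤ K)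
    {a b : ℕ} (ha : 1 ≤ a) (hb : 1 ≤ b) (hab : a + b ≤ m) (he : Even (a + b)) (h2K : 2 * K ≤ a + b)
    (x : ZMod m) (e1 : G.Adj (g x) (g (x + (a : ZMod m))))
    (e2 : G.Adj (g (x + 1)) (g (x + 1 - (b : ZMod m)))) : False := by
  obtain ⟨b, rfl⟩ : ∃ b', b = b' + 1 := ⟨b - 1, by omega⟩
  obtain ⟨l, hl, hlen⟩ := cyc_T1 (G := G) (m := m) (h := fun i : ℕ => g (x - (b : ZMod m) + (i : ZMod m)))
    (a := a) (b := b + 1)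
    (base_inj hinj _) (base_adj hadj _) ha hb hab (by omega)
    (by
      have : b + 1 + a - 1 = b + a := by omega
      simp only [this, Nat.add_sub_cancel]
      convert e1 using 2 <;> push_cast <;> ring)
    (by convert e2 using 2 <;> push_cast <;> ring)
  have := hno l hl (hlen ▸ he)
  omega

theorem ham_T2 (hinj : Function.Injective g) (hadj : ∀ i, G.Adj (g i) (g (i + 1)))
    (hno : ∀ l, CL G l → Even l.length → l.length < 2 * K)
    {a b : ℕ} (ha : 3 ≤ a) (hb : 1 ≤ b) (hab : a + b + 2 ≤ m) (h2K : 2 * K = a + b + 2)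
    (x : ZMod m) (e1 : G.Adj (g x) (g (x + (a : ZMod m))))
    (e2 : G.Adj (g (x + (a : ZMod m) + 2)) (g (x + (a : ZMod m) - 1)))
    (e3 : G.Adj (g (x + 1)) (g (x + 1 - (b : ZMod m)))) : False := by
  obtain ⟨b, rfl⟩ : ∃ b', b = b' + 1 := ⟨b - 1, by omega⟩
  obtain ⟨a, rfl⟩ : ∃ b', a = b' + 1 := ⟨a - 1, by omega⟩
  obtain ⟨l, hl, hlen⟩ := cyc_T2 (G := G) (m := m) (h := fun i : ℕ => g (x - (b : ZMod m) + (i : ZMod m)))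
    (a := a + 1) (b := b + 1)
    (base_inj hinj _) (base_adj hadj _) ha hb hab
    (by
      have : b + 1 + (a + 1) - 1 = b + a + 1 := by omega
      simp only [this, Nat.add_sub_cancel]
      convert e1 using 2 <;> push_cast <;> ring)
    (by
      have : b + 1 + (a + 1) - 2 = b + a := by omega
      simp only [this]
      convert e2 using 2 <;> push_cast <;> ring)
    (by convert e3 using 2 <;> push_cast <;> ring)
  have := hno l hl (by rw [hlen, ← h2K]; exact even_two_mul K)
  omega

theorem ham_T3 (hinj : Function.Injective g) (hadj : ∀ i, G.Adj (g i) (g (i + 1)))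
    (hno : ∀ l, CL G l → Even l.length → l.length < 2 * K) (hK : 3 ≤ K) (hm : m = 2 * K + 1)
    (hQ : ∀ x, G.Adj (g x) (g (x + ((2 * K - 3 : ℕ) : ZMod m)))) : False := by
  have hz : ((2 * K - 3 : ℕ) : ZMod m) + 4 = 0 := by
    have : ((2 * K - 3 + 4 : ℕ) : ZMod m) = 0 := by
      rw [show 2 * K - 3 + 4 = m by omega, ZMod.natCast_self]
    simpa using this
  obtain ⟨l, hl, hlen⟩ := cyc_T3 (G := G) (m := m) (h := fun i : ℕ => g (0 + (i : ZMod m))) (K := K)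
    (base_inj hinj _) (base_adj hadj _) hK (by omega)
    (by
      have := hQ 2
      rw [show 2 * K - 1 = 2 * K - 3 + 2 by omega]
      convert this using 2 <;> push_cast <;> ring)
    (by
      have := hQ 3
      rw [show 2 * K = 2 * K - 3 + 3 by omega]
      convert this.symm using 2 <;> push_cast <;> ring)
    (by
      have := (hQ 0).symm
      convert this using 2 ; push_cast; ring)
  have := hno l hl (by rw [hlen]; exact even_two_mul K)
  omega

noncomputable def FF (G : SimpleGraph V) (g : ZMod m → V) (K : ℕ) (x : ZMod m) : Finset ℕ :=
  (Finset.range K).filter fun i => G.Adj (g x) (g (x + ((2 * i + 1 : ℕ) : ZMod m)))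

noncomputable def BB (G : SimpleGraph V) (g : ZMod m → V) (K : ℕ) (x : ZMod m) : Finset ℕ :=
  (Finset.range K).filter fun i => G.Adj (g x) (g (x - ((2 * i + 1 : ℕ) : ZMod m)))

theorem ham_case [Fintype V] (hK : 3 ≤ K) (hm : 2 * K + 1 ≤ m) (hodd : Odd m)
    (hinj : Function.Injective g) (hsurj : Function.Surjective g)
    (hadj : ∀ i, G.Adj (g i) (g (i + 1)))
    (hdeg : ∀ v, K ≤ G.degree v)
    (hno : ∀ l, CL G l → Even l.length → l.length < 2 * K) : False := by
  have : NeZero m := ⟨by omega⟩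
  have hF : ∀ x i, i ∈ FF G g K x ↔ i < K ∧ G.Adj (g x) (g (x + ((2 * i + 1 : ℕ) : ZMod m))) := by
    intro x i; simp only [FF, Finset.mem_filter, Finset.mem_range]
  have hB : ∀ x i, i ∈ BB G g K x ↔ i < K ∧ G.Adj (g x) (g (x - ((2 * i + 1 : ℕ) : ZMod m))) := by
    intro x i; simp only [BB, Finset.mem_filter, Finset.mem_range]
  -- the basic exclusion
  have hex : ∀ x i j, i ∈ FF G g K x → j ∈ BB G g K (x + 1) → K ≤ i + j + 1 → 2 * (i + j + 1) ≤ m → False := by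
    intro x i j hi hj h1 h2
    rw [hF] at hi; rw [hB] at hj
    exact ham_T1 hinj hadj hno hK (a := 2 * i + 1) (b := 2 * j + 1) (by omega) (by omega) (by omega)
      ⟨i + j + 1, by ring⟩ (by omega) x hi.2 hj.2
  have hle : ∀ x, (FF G g K x).card + (BB G g K (x + 1)).card ≤ K := by
    intro x
    have hsub : (BB G g K (x + 1)) ⊆ Finset.range K \ (FF G g K x).image (fun i => K - 1 - i) := by
      intro j hj
      rw [Finset.mem_sdiff, Finset.mem_image]
      have hjK := ((hB _ _).1 hj).1
      refine ⟨Finset.mem_range.2 hjK, ?_⟩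
      rintro ⟨i, hi, hij⟩
      have hiK := ((hF _ _).1 hi).1
      exact hex x i j hi hj (by omega) (by omega)
    have h1 := Finset.card_le_card hsub
    have hsub2 : (FF G g K x).image (fun i => K - 1 - i) ⊆ Finset.range K := by
      intro j hj
      rw [Finset.mem_image] at hj
      obtain ⟨i, hi, rfl⟩ := hj
      rw [Finset.mem_range]; omega
    rw [Finset.card_sdiff_of_subset hsub2, Finset.card_range, Finset.card_image_of_injOn] at h1
    · have h2 := Finset.card_le_card hsub2
      rw [Finset.card_range, Finset.card_image_of_injOn] at h2
      · omega
      · intro i hi j hj hij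
        have hiK := ((hF _ _).1 hi).1
        have hjK := ((hF _ _).1 hj).1
        simp only at hij; omega
    · intro i hi j hj hij
      have hiK := ((hF _ _).1 hi).1
      have hjK := ((hF _ _).1 hj).1
      simp only at hij; omega
  -- long chords
  have hlong : ∀ (x : ZMod m) (d : ℕ), Odd d → d < m → G.Adj (g x) (g (x + (d : ZMod m))) → d < 2 * K := by
    intro x d hd hdm hxd
    by_contra hcon
    have hev : Even (d + 1) := hd.add_one
    have : d + 1 ≤ m := hdm
    refine ham_T1 hinj hadj hno hK (a := d) (b := 1) (by omega) le_rfl this hev (by omega) x hxd ?_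
    have := (hadj x).symm
    simpa using this
  have hge : ∀ x, K ≤ (FF G g K x).card + (BB G g K x).card := by
    intro x
    refine (hdeg (g x)).trans ?_
    rw [← SimpleGraph.card_neighborFinset_eq_degree]
    have hsub : G.neighborFinset (g x) ⊆
        (FF G g K x).image (fun i => g (x + ((2 * i + 1 : ℕ) : ZMod m))) ∪
        (BB G g K x).image (fun i => g (x - ((2 * i + 1 : ℕ) : ZMod m))) := by
      intro v hv
      rw [SimpleGraph.mem_neighborFinset] at hv
      obtain ⟨y, rfl⟩ := hsurj v
      rw [Finset.mem_union, Finset.mem_image, Finset.mem_image]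
      have hdv : ((y - x).val : ZMod m) = y - x := ZMod.natCast_zmod_val _
      have hdm := ZMod.val_lt (y - x)
      set d := (y - x).val with hd
      rcases Nat.even_or_odd d with he | ho
      · right
        have hod : Odd (m - d) := Nat.Odd.sub_even hdm.le hodd he
        have hcast : ((m - d : ℕ) : ZMod m) = x - y := by
          rw [Nat.cast_sub hdm.le, ZMod.natCast_self, hdv]; ring
        have hd0 : d ≠ 0 := by
          intro h0
          rw [h0, Nat.cast_zero] at hdv
          have : y = x := (sub_eq_zero.1 hdv.symm)
          rw [this] at hv
          exact G.loopless.irrefl _ hv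
        have hlt := hlong y (m - d) hod (by omega) (by rw [hcast]; simpa using hv.symm)
        obtain ⟨i, hi⟩ := hod
        have heq : x - ((2 * i + 1 : ℕ) : ZMod m) = y := by rw [← hi, hcast]; ring
        exact ⟨i, (hB _ _).2 ⟨by omega, by rw [heq]; exact hv⟩, by rw [heq]⟩
      · left
        have hlt := hlong x d ho hdm (by rw [hdv]; simpa using hv)
        obtain ⟨i, hi⟩ := ho
        have heq : x + ((2 * i + 1 : ℕ) : ZMod m) = y := by rw [← hi, hdv]; ring
        exact ⟨i, (hF _ _).2 ⟨by omega, by rw [heq]; exact hv⟩, by rw [heq]⟩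
    refine (Finset.card_le_card hsub).trans ((Finset.card_union_le _ _).trans ?_)
    exact Nat.add_le_add Finset.card_image_le Finset.card_image_le
  have hshift : ∑ x : ZMod m, (BB G g K (x + 1)).card = ∑ x : ZMod m, (BB G g K x).card :=
    Equiv.sum_comp (Equiv.addRight (1 : ZMod m)) (fun x => (BB G g K x).card)
  have hs1 : ∑ x : ZMod m, ((FF G g K x).card + (BB G g K (x + 1)).card) =
      ∑ x : ZMod m, ((FF G g K x).card + (BB G g K x).card) := by
    rw [Finset.sum_add_distrib, Finset.sum_add_distrib, hshift]
  have hs2 : ∑ x : ZMod m, ((FF G g K x).card + (BB G g K (x + 1)).card) ≤ ∑ x : ZMod m, K :=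
    Finset.sum_le_sum fun x _ => hle x
  have hs3 : ∑ x : ZMod m, K ≤ ∑ x : ZMod m, ((FF G g K x).card + (BB G g K x).card) :=
    Finset.sum_le_sum fun x _ => hge x
  have heq1 : ∀ x, (FF G g K x).card + (BB G g K (x + 1)).card = K := by
    intro x
    exact (Finset.sum_eq_sum_iff_of_le (fun x _ => hle x)).1 (by omega) x (Finset.mem_univ _)
  have heq2 : ∀ x, K = (FF G g K x).card + (BB G g K x).card := by
    intro x
    exact (Finset.sum_eq_sum_iff_of_le (fun x _ => hge x)).1 (by omega) x (Finset.mem_univ _)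
  have hBc : ∀ x, (BB G g K (x + 1)).card = (BB G g K x).card := by
    intro x; have := heq1 x; have := heq2 x; omega
  -- exact complementarity
  have hcomp : ∀ x i, i < K → i ∉ FF G g K x → K - 1 - i ∈ BB G g K (x + 1) := by
    intro x i hi hiF
    by_contra hcon
    have hsub : (BB G g K (x + 1)) ⊆
        Finset.range K \ (insert i (FF G g K x)).image (fun i => K - 1 - i) := by
      intro j hj
      rw [Finset.mem_sdiff, Finset.mem_image]
      have hjK := ((hB _ _).1 hj).1
      refine ⟨Finset.mem_range.2 hjK, ?_⟩
      rintro ⟨i', hi', hij⟩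
      rw [Finset.mem_insert] at hi'
      rcases hi' with rfl | hi'
      · rw [hij] at hcon; exact hcon hj
      have hiK := ((hF _ _).1 hi').1
      exact hex x i' j hi' hj (by omega) (by omega)
    have h1 := Finset.card_le_card hsub
    have hsub2 : (insert i (FF G g K x)).image (fun i => K - 1 - i) ⊆ Finset.range K := by
      intro j hj
      rw [Finset.mem_image] at hj
      obtain ⟨i, hi, rfl⟩ := hj
      rw [Finset.mem_range]; omega
    have hinj2 : Set.InjOn (fun i => K - 1 - i) (insert i (FF G g K x) : Finset ℕ) := by
      have hlt : ∀ i' ∈ insert i (FF G g K x), i' < K := by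
        intro i' hi'
        rw [Finset.mem_insert] at hi'
        rcases hi' with rfl | hi'
        · exact hi
        · exact ((hF _ _).1 hi').1
      intro i hi j hj hij
      have hiK := hlt i hi
      have hjK := hlt j hj
      simp only at hij; omega
    have h2 := Finset.card_le_card hsub2
    rw [Finset.card_sdiff_of_subset hsub2, Finset.card_range, Finset.card_image_of_injOn hinj2,
      Finset.card_insert_of_notMem hiF] at h1
    rw [Finset.card_range, Finset.card_image_of_injOn hinj2, Finset.card_insert_of_notMem hiF] at h2
    have := heq1 x
    omega
  -- relation between F and B
  have hFB : ∀ x i, i ∈ BB G g K x → i ∈ FF G g K (x - ((2 * i + 1 : ℕ) : ZMod m)) := by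
    intro x i hi
    rw [hB] at hi; rw [hF]
    refine ⟨hi.1, ?_⟩
    rw [sub_add_cancel]; exact hi.2.symm
  have hBF : ∀ x i, i ∈ FF G g K x → i ∈ BB G g K (x + ((2 * i + 1 : ℕ) : ZMod m)) := by
    intro x i hi
    rw [hF] at hi; rw [hB]
    refine ⟨hi.1, ?_⟩
    rw [add_sub_cancel_right]; exact hi.2.symm
  have h0F : ∀ x, 0 ∈ FF G g K x := by
    intro x; rw [hF]; refine ⟨by omega, ?_⟩; simpa using hadj x
  have h0B : ∀ x, 0 ∈ BB G g K x := by
    intro x; rw [hB]; refine ⟨by omega, ?_⟩; simpa using (hadj (x - 1)).symm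
  have hlast : ∀ x, K - 1 ∉ BB G g K x := by
    intro x hx
    refine hex (x - 1) 0 (K - 1) (h0F _) ?_ (by omega) (by omega)
    rwa [sub_add_cancel]
  -- no chords of span 3
  have h3 : ∀ w, 1 ∉ FF G g K w := by
    intro w hw
    have hstep : ∀ i ∈ BB G g K (w + 1), 1 ≤ i → i + 1 ∈ BB G g K (w + 3) := by
      intro i hi hi1
      have hiK := ((hB _ _).1 hi).1
      have hiK' : i + 1 < K := by
        rcases Nat.lt_or_ge (i + 1) K with h | h
        · exact h
        · exact absurd (by rwa [show i = K - 1 by omega] at hi) (hlast (w + 1))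
      by_contra hcon
      set x : ZMod m := w + 1 - ((2 * i + 1 : ℕ) : ZMod m) with hx
      have hxi : i ∈ FF G g K x := hFB _ _ hi
      have hnot : i + 1 ∉ FF G g K x := by
        intro h
        apply hcon
        have := hBF _ _ h
        convert this using 2
        rw [hx]; push_cast; ring
      have hb := hcomp x (i + 1) hiK' hnot
      have hwF := ((hF _ _).1 hw).2
      have ex1 : x + ((2 * i + 1 : ℕ) : ZMod m) = w + 1 := by rw [hx]; ring
      refine ham_T2 hinj hadj hno (a := 2 * i + 1) (b := 2 * (K - 1 - (i + 1)) + 1) (by omega) (by omega)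
        (by omega) (by omega) x ((hF _ _).1 hxi).2 ?_ ((hB _ _).1 hb).2
      rw [ex1]
      convert hwF.symm using 2 <;> push_cast <;> ring
    have h13 : 1 ∈ BB G g K (w + 3) := by
      have := hBF _ _ hw
      convert this using 2
      push_cast; ring
    have hsub : insert 1 (insert 0 (((BB G g K (w + 1)).erase 0).image (· + 1))) ⊆ BB G g K (w + 3) := by
      intro j hj
      rw [Finset.mem_insert, Finset.mem_insert, Finset.mem_image] at hj
      rcases hj with rfl | rfl | ⟨i, hi, rfl⟩
      · exact h13
      · exact h0B _
      · rw [Finset.mem_erase] at hi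
        exact hstep i hi.2 (by omega)
    have hc := Finset.card_le_card hsub
    rw [Finset.card_insert_of_notMem, Finset.card_insert_of_notMem, Finset.card_image_of_injective,
      Finset.card_erase_of_mem (h0B _)] at hc
    · have e1 := hBc (w + 1)
      have e2 := hBc (w + 1 + 1)
      have e3 : w + 1 + 1 + 1 = w + 3 := by ring
      rw [e3] at e2
      have := Finset.card_pos.2 ⟨0, h0B (w + 1)⟩
      omega
    · intro a b h; simpa using h
    · simp
    · simp
  have hQ : ∀ x, K - 2 ∈ BB G g K (x + 1) := by
    intro x
    have := hcomp x 1 (by omega) (h3 x)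
    rwa [show K - 1 - 1 = K - 2 by omega] at this
  rcases Nat.lt_or_ge m (2 * K + 2) with hmlt | hmge
  · refine ham_T3 hinj hadj hno hK (by omega) ?_
    intro x
    have h1 := hFB _ _ (hQ (x + ((2 * (K - 2) + 1 : ℕ) : ZMod m) - 1))
    rw [hF] at h1
    have h2 := h1.2
    rw [show 2 * K - 3 = 2 * (K - 2) + 1 by omega]
    convert h2 using 2 <;> ring
  · have hall : ∀ x j, 1 ≤ j → j + 2 ≤ K → K - 1 - j ∈ BB G g K (x + 1) := by
      intro x j hj
      induction j, hj using Nat.le_induction with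
      | base => intro h; exact hcomp x 1 (by omega) (h3 x)
      | succ j hj ih =>
        intro h
        have := ih (by omega)
        refine hcomp x (j + 1) (by omega) ?_
        intro hF1
        refine hex x _ _ hF1 this (by omega) ?_
        have : m ≠ 2 * K + 2 := by
          rintro rfl
          have : Even (2 * K + 2) := ⟨K + 1, by ring⟩
          exact (Nat.not_even_iff_odd.2 hodd) this
        omega
    have h1 := hall 0 (K - 2) (by omega) (by omega)
    rw [show K - 1 - (K - 2) = 1 by omega] at h1
    exact h3 _ (hFB _ _ h1)
end ham
/-! Connected sets, lobes, and long paths. -/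

theorem PL.initSeg {V : Type*} {G : SimpleGraph V} {l : List V} {a b v : V}
    (h : PL G l a b) (hv : v ∈ l) : ∃ s, PL G s a v ∧ ∀ w ∈ s, w ∈ l := by
  obtain ⟨s, t, rfl⟩ := List.append_of_mem hv
  obtain ⟨hn, hc, ha, hb⟩ := h
  rw [List.append_cons] at hn hc ha
  refine ⟨s ++ [v], ⟨(List.nodup_append.1 hn).1, hc.left_of_append, ?_, by simp⟩, ?_⟩
  · cases s <;> simpa using ha
  · intro w hw
    simp only [List.mem_append, List.mem_cons, List.not_mem_nil, or_false] at hw ⊢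
    tauto

theorem PL.uncons {V : Type*} {G : SimpleGraph V} {l : List V} {a b : V}
    (h : PL G l a b) (hab : a ≠ b) :
    ∃ t c, l = a :: t ∧ PL G t c b ∧ G.Adj a c ∧ a ∉ t := by
  obtain ⟨hn, hc, ha, hb⟩ := h
  match l with
  | [] => simp at ha
  | [x] =>
    simp at ha hb
    exact absurd (ha.symm.trans hb) hab
  | x :: y :: t =>
    simp only [List.head?_cons, Option.some.injEq] at ha
    subst ha
    refine ⟨y :: t, y, rfl, ⟨(List.nodup_cons.1 hn).2, hc.of_cons, rfl, ?_⟩, hc.rel,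
      (List.nodup_cons.1 hn).1⟩
    simpa using hb

theorem PL.unsnoc {V : Type*} {G : SimpleGraph V} {l : List V} {a b : V}
    (h : PL G l a b) (hab : a ≠ b) :
    ∃ t c, PL G t a c ∧ G.Adj c b ∧ l.length = t.length + 1 ∧ ∀ v ∈ t, v ∈ l ∧ v ≠ b := by
  obtain ⟨t, c, h1, h2, h3, h4⟩ := h.reverse.uncons hab.symm
  refine ⟨t.reverse, c, h2.reverse, h3.symm, ?_, ?_⟩
  · have := congrArg List.length h1
    simpa using this
  · intro v hv
    rw [List.mem_reverse] at hv
    refine ⟨?_, ?_⟩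
    · rw [← List.mem_reverse, h1]
      exact List.mem_cons_of_mem _ hv
    · rintro rfl; exact h4 hv

theorem PL.trans {V : Type*} {G : SimpleGraph V} {l₁ l₂ : List V} {a b c : V}
    (h₁ : PL G l₁ a b) (h₂ : PL G l₂ b c) (hd : ∀ v ∈ l₁, v ∈ l₂ → v = b) :
    ∃ l, PL G l a c ∧ (∀ v ∈ l, v ∈ l₁ ∨ v ∈ l₂) ∧ l₁.length ≤ l.length := by
  by_cases hbc : b = c
  · subst hbc
    exact ⟨l₁, h₁, fun v hv => Or.inl hv, le_rfl⟩
  · obtain ⟨t, d, rfl, ht, hadj, hbt⟩ := h₂.uncons hbc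
    refine ⟨l₁ ++ t, h₁.append ht hadj ?_, ?_, by simp⟩
    · intro v hv hvt
      have := hd v hv (List.mem_cons_of_mem _ hvt)
      subst this; exact hbt hvt
    · intro v hv
      rw [List.mem_append] at hv
      rcases hv with hv | hv
      · exact Or.inl hv
      · exact Or.inr (List.mem_cons_of_mem _ hv)

def CS {V : Type*} (G : SimpleGraph V) (T : Finset V) : Prop :=
  ∀ D, D ⊆ T → D.Nonempty → D ≠ T → ∃ u ∈ D, ∃ v ∈ T, v ∉ D ∧ G.Adj u v

theorem CS.of_root {V : Type*} {G : SimpleGraph V} {T : Finset V} (r : V)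
    (h : ∀ D, D ⊆ T → D.Nonempty → r ∉ D → ∃ u ∈ D, ∃ v ∈ T, v ∉ D ∧ G.Adj u v) : CS G T := by
  intro D hD hne hDT
  by_cases hr : r ∈ D
  · have hne' : (T \ D).Nonempty := by
      rw [Finset.sdiff_nonempty]
      intro h; exact hDT (Finset.Subset.antisymm hD h)
    obtain ⟨u, hu, v, hv, hvD, huv⟩ := h (T \ D) Finset.sdiff_subset hne'
      (fun h => (Finset.mem_sdiff.1 h).2 hr)
    rw [Finset.mem_sdiff] at hu hvD
    refine ⟨v, ?_, u, hu.1, hu.2, huv.symm⟩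
    by_contra hcon
    exact hvD ⟨hv, hcon⟩
  · exact h D hD hne hr

theorem CS.path {V : Type*} {G : SimpleGraph V} {T : Finset V} (h : CS G T) {a b : V}
    (ha : a ∈ T) (hb : b ∈ T) : ∃ l, PL G l a b ∧ ∀ v ∈ l, v ∈ T := by
  let D := T.filter fun v => ∃ l, PL G l a v ∧ ∀ v ∈ l, v ∈ T
  by_cases hD : D = T
  · rw [← hD] at hb
    exact (Finset.mem_filter.1 hb).2
  · exfalso
    obtain ⟨u, hu, v, hv, hvD, huv⟩ := h D (Finset.filter_subset _ _)
      ⟨a, Finset.mem_filter.2 ⟨ha, [a], PL.single a, by simpa using ha⟩⟩ hD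
    obtain ⟨l, hl, hlT⟩ := (Finset.mem_filter.1 hu).2
    apply hvD
    refine Finset.mem_filter.2 ⟨hv, ?_⟩
    by_cases hvl : v ∈ l
    · obtain ⟨s, hs, hs'⟩ := hl.initSeg hvl
      exact ⟨s, hs, fun w hw => hlT w (hs' w hw)⟩
    · refine ⟨l ++ [v], hl.append (PL.single v) huv ?_, ?_⟩
      · intro w hw hwv
        rw [List.mem_singleton] at hwv
        subst hwv; exact hvl hw
      · intro w hw
        rw [List.mem_append, List.mem_singleton] at hw
        rcases hw with hw | rfl
        · exact hlT w hw
        · exact hv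

theorem lobe {V : Type*} {G : SimpleGraph V} {A : Finset V} {b : V}
    (hA : A.Nonempty) (hb : b ∉ A) (hcs : CS G (insert b A)) :
    ∃ (S : Finset V) (b' : V), S ⊆ A ∧ S.Nonempty ∧ b' ∈ insert b A ∧ b' ∉ S ∧
      (∀ u ∈ S, ∀ v ∈ insert b A, G.Adj u v → v ∈ insert b' S) ∧
      CS G (insert b' S) ∧ (∀ c ∈ insert b' S, CS G ((insert b' S).erase c)) ∧
      CS G ((insert b A) \ S) := by
  let P : Finset V → Prop := fun S => S.Nonempty ∧ ∃ b' ∈ insert b A, b' ∉ S ∧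
    ∀ u ∈ S, ∀ v ∈ insert b A, G.Adj u v → v ∈ insert b' S
  have hne : (A.powerset.filter P).Nonempty :=
    ⟨A, Finset.mem_filter.2 ⟨Finset.mem_powerset_self A, hA, b, Finset.mem_insert_self _ _, hb,
      fun u _ v hv _ => hv⟩⟩
  obtain ⟨S, hS, hmin⟩ := Finset.exists_min_image _ Finset.card hne
  obtain ⟨hSA, hSne, b', hb'A, hb'S, hcl⟩ := Finset.mem_filter.1 hS
  rw [Finset.mem_powerset] at hSA
  have hmin' : ∀ D, D ⊆ A → D.card < S.card → ¬ P D := by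
    intro D hD hlt hP
    have := hmin D (Finset.mem_filter.2 ⟨Finset.mem_powerset.2 hD, hP⟩)
    omega
  have hSb : insert b' S ⊆ insert b A := by
    intro v hv
    rcases Finset.mem_insert.1 hv with rfl | hv
    · exact hb'A
    · exact Finset.mem_insert_of_mem (hSA hv)
  refine ⟨S, b', hSA, hSne, hb'A, hb'S, hcl, ?_, ?_, ?_⟩
  · apply CS.of_root b'
    intro D hD hDne hDb
    obtain ⟨u, hu, v, hv, hvD, huv⟩ := hcs D (hD.trans hSb) hDne (by rintro rfl; exact hDb hb'A)
    have huS : u ∈ S := (Finset.mem_insert.1 (hD hu)).resolve_left (by rintro rfl; exact hDb hu)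
    exact ⟨u, hu, v, hcl u huS v hv huv, hvD, huv⟩
  · intro c hc
    by_cases hcb : c = b'
    · subst hcb
      rw [Finset.erase_insert hb'S]
      intro D hD hDne hDS
      by_contra hcon
      push Not at hcon
      refine hmin' D (hD.trans hSA) (Finset.card_lt_card (Finset.ssubset_iff_subset_ne.2 ⟨hD, hDS⟩))
        ⟨hDne, c, hb'A, fun h => hb'S (hD h), ?_⟩
      intro u hu v hv huv
      rcases Finset.mem_insert.1 (hcl u (hD hu) v hv huv) with h | h
      · exact h ▸ Finset.mem_insert_self _ _
      · by_cases hvD : v ∈ D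
        · exact Finset.mem_insert_of_mem hvD
        · exact absurd huv (hcon u hu v h hvD)
    · have hcS : c ∈ S := (Finset.mem_insert.1 hc).resolve_left hcb
      apply CS.of_root b'
      intro D hD hDne hDb
      have hDS : ∀ v ∈ D, v ∈ S ∧ v ≠ c := by
        intro v hv
        have h1 := Finset.mem_erase.1 (hD hv)
        exact ⟨(Finset.mem_insert.1 h1.2).resolve_left (by rintro rfl; exact hDb hv), h1.1⟩
      by_contra hcon
      push Not at hcon
      refine hmin' D (fun v hv => hSA (hDS v hv).1) (Finset.card_lt_card
        (Finset.ssubset_iff_subset_ne.2 ⟨fun v hv => (hDS v hv).1, ?_⟩))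
        ⟨hDne, c, Finset.mem_insert_of_mem (hSA hcS), fun h => (hDS c h).2 rfl, ?_⟩
      · rintro rfl; exact (hDS c hcS).2 rfl
      · intro u hu v hv huv
        by_cases hvc : v = c
        · exact hvc ▸ Finset.mem_insert_self _ _
        · by_cases hvD : v ∈ D
          · exact Finset.mem_insert_of_mem hvD
          · exact absurd huv (hcon u hu v
              (Finset.mem_erase.2 ⟨hvc, hcl u (hDS u hu).1 v hv huv⟩) hvD)
  · apply CS.of_root b'
    intro D hD hDne hDb
    obtain ⟨u, hu, v, hv, hvD, huv⟩ := hcs D (hD.trans Finset.sdiff_subset) hDne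
      (by rintro rfl; exact hDb hb'A)
    refine ⟨u, hu, v, Finset.mem_sdiff.2 ⟨hv, ?_⟩, hvD, huv⟩
    intro hvS
    have hu' := Finset.mem_sdiff.1 (hD hu)
    rcases Finset.mem_insert.1 (hcl v hvS u hu'.1 huv.symm) with rfl | h
    · exact hDb hu
    · exact hu'.2 h

theorem long_path {V : Type*} [Fintype V] {G : SimpleGraph V} (k : ℕ) :
    ∀ (S : Finset V) (b x : V), b ∉ S → x ∈ S →
      (∀ v ∈ S, k ≤ (G.neighborFinset v ∩ insert b S).card) →
      CS G (insert b S) → (∀ c ∈ insert b S, CS G ((insert b S).erase c)) →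
      ∃ l, PL G l x b ∧ (∀ v ∈ l, v ∈ insert b S) ∧ k + 1 ≤ l.length := by
  induction k with
  | zero =>
    intro S b x hb hx _ hcs _
    obtain ⟨l, hl, hl'⟩ := hcs.path (Finset.mem_insert_of_mem hx) (Finset.mem_insert_self _ _)
    exact ⟨l, hl, hl', List.length_pos_of_mem hl.head_mem⟩
  | succ k ih =>
    intro S b x hb hx hdeg hcs hcs2
    have hxb : x ≠ b := by rintro rfl; exact hb hx
    by_cases hA : (S.erase x).Nonempty
    · have heq : insert b (S.erase x) = (insert b S).erase x := by
        rw [Finset.erase_insert_of_ne hxb.symm]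
      obtain ⟨S', b', hSA, hSne, hb'A, hb'S, hcl, h1, h2, h3⟩ :=
        lobe hA (fun h => hb (Finset.mem_of_mem_erase h))
          (heq ▸ hcs2 x (Finset.mem_insert_of_mem hx))
      have hb'x : b' ≠ x ∧ b' ∈ insert b S := by
        rw [heq, Finset.mem_erase] at hb'A; exact hb'A
      have hxS' : x ∉ S' := fun h => (Finset.mem_erase.1 (hSA h)).1 rfl
      have hS'S : ∀ v ∈ S', v ∈ S := fun v hv => (Finset.mem_erase.1 (hSA hv)).2
      obtain ⟨u, hu, v, hv, hvS, huv⟩ := hcs2 b' hb'x.2 S'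
        (by
          intro v hv
          exact Finset.mem_erase.2 ⟨by rintro rfl; exact hb'S hv,
            Finset.mem_insert_of_mem (hS'S v hv)⟩) hSne
        (by
          intro h
          apply hxS'
          rw [h]
          exact Finset.mem_erase.2 ⟨hb'x.1.symm, Finset.mem_insert_of_mem hx⟩)
      rw [Finset.mem_erase] at hv
      have hvx : v = x := by
        by_contra hvx
        have := hcl u hu v (by rw [heq]; exact Finset.mem_erase.2 ⟨hvx, hv.2⟩) huv
        rcases Finset.mem_insert.1 this with h | h
        · exact hv.1 h
        · exact hvS h
      subst hvx
      obtain ⟨l1, hl1, hl1S, hlen⟩ := ih S' b' u hb'S hu (by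
        intro w hw
        have hsub : G.neighborFinset w ∩ insert b S ⊆
            insert v (G.neighborFinset w ∩ insert b' S') := by
          intro z hz
          rw [Finset.mem_inter] at hz
          by_cases hzx : z = v
          · exact hzx ▸ Finset.mem_insert_self _ _
          · refine Finset.mem_insert_of_mem (Finset.mem_inter.2 ⟨hz.1, ?_⟩)
            refine hcl w hw z ?_ ((G.mem_neighborFinset w z).1 hz.1)
            rw [heq]; exact Finset.mem_erase.2 ⟨hzx, hz.2⟩
        have c1 := Finset.card_le_card hsub
        have c2 := Finset.card_insert_le v (G.neighborFinset w ∩ insert b' S')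
        have c3 := hdeg w (hS'S w hw)
        omega) h1 h2
      obtain ⟨l2, hl2, hl2S⟩ := h3.path (Finset.mem_sdiff.2 ⟨hb'A, hb'S⟩)
        (Finset.mem_sdiff.2 ⟨Finset.mem_insert_self _ _, fun h => hb (hS'S b h)⟩)
      obtain ⟨l3, hl3, hl3S, hlen3⟩ := hl1.trans hl2 (by
        intro w hw hw2
        rcases Finset.mem_insert.1 (hl1S w hw) with h | h
        · exact h
        · exact absurd h (Finset.mem_sdiff.1 (hl2S w hw2)).2)
      have hl3A : ∀ w ∈ l3, w ∈ (insert b S).erase v := by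
        intro w hw
        rcases hl3S w hw with h | h
        · rcases Finset.mem_insert.1 (hl1S w h) with h | h
          · rw [h, ← heq]; exact hb'A
          · rw [← heq]; exact Finset.mem_insert_of_mem (hSA h)
        · rw [← heq]; exact (Finset.mem_sdiff.1 (hl2S w h)).1
      refine ⟨[v] ++ l3, (PL.single v).append hl3 huv.symm ?_, ?_, ?_⟩
      · intro w hw hw3
        rw [List.mem_singleton] at hw
        exact (Finset.mem_erase.1 (hl3A w hw3)).1 hw
      · intro w hw
        rw [List.mem_append, List.mem_singleton] at hw
        rcases hw with rfl | hw
        · exact Finset.mem_insert_of_mem hx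
        · exact (Finset.mem_erase.1 (hl3A w hw)).2
      · simp only [List.length_append, List.length_singleton]; omega
    · obtain ⟨l, hl, hl'⟩ := hcs.path (Finset.mem_insert_of_mem hx) (Finset.mem_insert_self _ _)
      obtain ⟨t, c, rfl, ht, _, _⟩ := hl.uncons hxb
      have := List.length_pos_of_mem ht.head_mem
      have hsub : G.neighborFinset x ∩ insert b S ⊆ {b} := by
        intro z hz
        rw [Finset.mem_inter, SimpleGraph.mem_neighborFinset] at hz
        rw [Finset.mem_singleton]
        rcases Finset.mem_insert.1 hz.2 with h | h
        · exact h
        · exfalso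
          exact hA ⟨z, Finset.mem_erase.2 ⟨hz.1.ne', h⟩⟩
      have c1 := Finset.card_le_card hsub
      have c2 := hdeg x hx
      rw [Finset.card_singleton] at c1
      refine ⟨_, hl, hl', ?_⟩
      simp only [List.length_cons]; omega

/-! The non-Hamiltonian case. -/

section nonham
variable {V : Type*} {G : SimpleGraph V} {m K : ℕ} {g : ZMod m → V}

theorem ear_len (hinj : Function.Injective g) (hadj : ∀ i, G.Adj (g i) (g (i + 1)))
    (hmax : ∀ l, CL G l → l.length ≤ m)
    (hno : ∀ l, CL G l → Even l.length → l.length < 2 * K)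
    (a c : ZMod m) (e : ℕ) (he : 1 ≤ e) (hem : e < m) (hc : c = a + (e : ZMod m))
    {l : List V} {x y : V} (hl : PL G l x y) (hd : ∀ i, g i ∉ l)
    (e1 : G.Adj (g c) x) (e2 : G.Adj y (g a)) :
    e + 1 + l.length ≤ m ∧ (Even (e + 1 + l.length) → e + 1 + l.length + 2 ≤ 2 * K) := by
  have hpos := List.length_pos_of_mem hl.head_mem
  obtain ⟨l', h1, h2⟩ := cyc_ear (h := fun i : ℕ => g (a + (i : ZMod m)))
    (base_inj hinj a) (base_adj hadj a) (s := 0) (n := e + 1) (by omega) (by omega) hl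
    (fun i => hd _) (by subst hc; simpa using e1) (by simpa using e2) (by omega)
  have h3 := hmax l' h1
  have h4 := hno l' h1
  rw [h2] at h3 h4
  refine ⟨h3, fun h => ?_⟩
  have := h4 h
  obtain ⟨t, ht⟩ := h
  omega

theorem ear_bound (hinj : Function.Injective g) (hadj : ∀ i, G.Adj (g i) (g (i + 1)))
    (hmax : ∀ l, CL G l → l.length ≤ m)
    (hno : ∀ l, CL G l → Even l.length → l.length < 2 * K)
    (hmK : Even m → m < 2 * K) (z : ZMod m) {l : List V} {u w : V} (hl : PL G l u w)
    (hd : ∀ i, g i ∉ l) (hw : G.Adj w (g z))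
    (hne : ((Finset.Ico 1 m).filter (fun D : ℕ => G.Adj u (g (z + (D : ZMod m))))).Nonempty) :
    ((Finset.Ico 1 m).filter (fun D : ℕ => G.Adj u (g (z + (D : ZMod m))))).card
      + (l.length + 1) ≤ K := by
  have hA : ∀ D ∈ (Finset.Ico 1 m).filter (fun D : ℕ => G.Adj u (g (z + (D : ZMod m)))),
      1 ≤ D ∧ D < m ∧ G.Adj u (g (z + (D : ZMod m))) := by
    intro D hD
    rw [Finset.mem_filter, Finset.mem_Ico] at hD
    exact ⟨hD.1.1, hD.1.2, hD.2⟩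
  have hB : ∀ D ∈ (Finset.Ico 1 m).filter (fun D : ℕ => G.Adj u (g (z + (D : ZMod m)))),
      D + 1 + l.length ≤ m ∧ (Even (D + 1 + l.length) → D + 1 + l.length + 2 ≤ 2 * K) := by
    intro D hD
    obtain ⟨h1, h2, h3⟩ := hA D hD
    exact ear_len hinj hadj hmax hno z _ D h1 h2 rfl hl hd h3.symm hw
  have hC : ∀ D ∈ (Finset.Ico 1 m).filter (fun D : ℕ => G.Adj u (g (z + (D : ZMod m)))),
      m - D + 1 + l.length ≤ m ∧
        (Even (m - D + 1 + l.length) → m - D + 1 + l.length + 2 ≤ 2 * K) := by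
    intro D hD
    obtain ⟨h1, h2, h3⟩ := hA D hD
    have := ear_len hinj hadj hmax hno (z + (D : ZMod m)) z (m - D) (by omega) (by omega)
      (by rw [Nat.cast_sub h2.le]; simp) hl.reverse (by simpa using hd) hw.symm h3
    simpa using this
  have hE : ∀ D ∈ (Finset.Ico 1 m).filter (fun D : ℕ => G.Adj u (g (z + (D : ZMod m)))),
      ∀ D' ∈ (Finset.Ico 1 m).filter (fun D : ℕ => G.Adj u (g (z + (D : ZMod m)))), D < D' →
      m - (D' - D) + 1 + 1 ≤ m ∧
        (Even (m - (D' - D) + 1 + 1) → m - (D' - D) + 1 + 1 + 2 ≤ 2 * K) := by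
    intro D hD D' hD' hlt
    obtain ⟨h1, h2, h3⟩ := hA D hD
    obtain ⟨h1', h2', h3'⟩ := hA D' hD'
    have := ear_len hinj hadj hmax hno (z + (D' : ZMod m)) (z + (D : ZMod m)) (m - (D' - D))
      (by omega) (by omega)
      (by rw [Nat.cast_sub (by omega), Nat.cast_sub hlt.le]; simp) (PL.single u)
      (by
        intro i hi
        rw [List.mem_singleton] at hi
        exact hd i (hi ▸ hl.head_mem)) h3.symm h3'
    simpa using this
  apply ear_arith _ hne m (l.length + 1) K
  · intro D hD
    have := (hB D hD).1
    have := (hC D hD).1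
    have := hA D hD
    omega
  · intro D hD h
    have e : D + (l.length + 1) = D + 1 + l.length := by omega
    rw [e] at h ⊢
    exact (hB D hD).2 h
  · intro D hD h
    have e : m - D + (l.length + 1) = m - D + 1 + l.length := by omega
    rw [e] at h ⊢
    exact (hC D hD).2 h
  · intro D hD D' hD' hlt
    have := (hE D hD D' hD' hlt).1
    have := hA D' hD'
    omega
  · intro D hD D' hD' hlt h
    exact (hE D hD D' hD' hlt).2 h
  · intro h
    have := hmK h
    obtain ⟨t, ht⟩ := h
    omega

theorem nonham_case [Fintype V] (hinj : Function.Injective g)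
    (hadj : ∀ i, G.Adj (g i) (g (i + 1))) (hm : 3 ≤ m)
    (hdeg : ∀ v, K ≤ G.degree v) (h2 : ∀ c, CS G (Finset.univ.erase c))
    (hmax : ∀ l, CL G l → l.length ≤ m)
    (hno : ∀ l, CL G l → Even l.length → l.length < 2 * K)
    (hmK : Even m → m < 2 * K) (hns : ¬ Function.Surjective g) : False := by
  have : NeZero m := ⟨by omega⟩
  let P : Finset V → Prop := fun A => A.Nonempty ∧ (∀ u ∈ A, ∀ i, g i ≠ u) ∧
    ∀ u ∈ A, ∀ v, G.Adj u v → v ∈ A ∨ ∃ i, g i = v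
  have hPne : (Finset.univ.filter P).Nonempty := by
    refine ⟨Finset.univ.filter (fun v => ∀ i, g i ≠ v), Finset.mem_filter.2
      ⟨Finset.mem_univ _, ?_, ?_, ?_⟩⟩
    · unfold Function.Surjective at hns
      push Not at hns
      obtain ⟨v, hv⟩ := hns
      exact ⟨v, by simpa using hv⟩
    · intro u hu
      simpa using hu
    · intro u hu v huv
      by_cases h : ∃ i, g i = v
      · exact Or.inr h
      · left
        push Not at h
        simpa using h
  obtain ⟨A, hAP, hAmin⟩ := Finset.exists_min_image _ Finset.card hPne
  obtain ⟨hAne, hAdis, hAcl⟩ := (Finset.mem_filter.1 hAP).2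
  have hg01 : g 1 ≠ g 0 := by
    have := (hadj 0).ne
    rw [zero_add] at this
    exact this.symm
  -- an attachment vertex on the cycle
  obtain ⟨u₀, hu₀, y, -, hyA, hu₀y⟩ := h2 (g 0) A
    (by intro v hv; simp; exact fun h => hAdis v hv 0 h.symm) hAne
    (by
      intro h
      have : g 1 ∈ A := by rw [h]; simpa using hg01
      exact hAdis _ this 1 rfl)
  obtain ⟨z, rfl⟩ := (hAcl u₀ hu₀ y hu₀y).resolve_left hyA
  have hcsA : CS G (insert (g z) A) := by
    apply CS.of_root (g z)
    intro D hD hDne hzD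
    have hDA : D ⊆ A := by
      intro v hv
      rcases Finset.mem_insert.1 (hD hv) with rfl | h
      · exact absurd hv hzD
      · exact h
    by_cases hDA' : D = A
    · subst hDA'
      exact ⟨u₀, hu₀, g z, by simp, hzD, hu₀y⟩
    · by_contra hcon
      push Not at hcon
      have hDP : P D := by
        refine ⟨hDne, fun u hu => hAdis u (hDA hu), fun u hu v huv => ?_⟩
        by_contra hv
        push Not at hv
        rcases hAcl u (hDA hu) v huv with h | ⟨i, hi⟩
        · exact hcon u hu v (Finset.mem_insert_of_mem h) hv.1 huv
        · exact hv.2 i hi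
      have := hAmin D (Finset.mem_filter.2 ⟨Finset.mem_univ _, hDP⟩)
      exact hDA' (Finset.eq_of_subset_of_card_le hDA this)
  obtain ⟨S, b, hSA, hSne, hbA, hbS, hScl, hcsS, hcsS2, hcsR⟩ := lobe hAne hyA hcsA
  let Cy : Finset V := (Finset.univ.image g).erase (g z)
  obtain ⟨u, huS, humax⟩ := Finset.exists_max_image S
    (fun v => (G.neighborFinset v ∩ Cy).card) hSne
  -- every neighbour is in the lobe or on the cycle
  have hcover : ∀ v ∈ S, G.neighborFinset v ⊆
      (G.neighborFinset v ∩ insert b S) ∪ (G.neighborFinset v ∩ Cy) := by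
    intro v hv w hw
    have hvw : G.Adj v w := by simpa using hw
    rw [Finset.mem_union, Finset.mem_inter, Finset.mem_inter]
    by_cases hwA : w ∈ insert (g z) A
    · exact Or.inl ⟨hw, hScl v hv w hwA hvw⟩
    · right
      refine ⟨hw, ?_⟩
      rw [Finset.mem_insert] at hwA
      push Not at hwA
      obtain ⟨i, hi⟩ := (hAcl v (hSA hv) w hvw).resolve_left hwA.2
      exact Finset.mem_erase.2 ⟨hwA.1, Finset.mem_image.2 ⟨i, Finset.mem_univ _, hi⟩⟩
  have hr1 : 1 ≤ (G.neighborFinset u ∩ Cy).card := by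
    obtain ⟨x, hxS, w, hw, hwS, hxw⟩ := h2 b S
      (by intro v hv; simp; rintro rfl; exact hbS hv) hSne
      (by
        intro h
        have key : ∀ i, g i = b := by
          intro i
          by_contra hi
          have : g i ∈ S := by rw [h]; simpa using hi
          exact hAdis _ (hSA this) i rfl
        exact hg01 ((key 1).trans (key 0).symm))
    have hwx : w ∈ G.neighborFinset x := by simpa using hxw
    have hwC : w ∈ G.neighborFinset x ∩ Cy := by
      rcases Finset.mem_union.1 (hcover x hxS hwx) with h | h
      · rw [Finset.mem_inter, Finset.mem_insert] at h
        rcases h.2 with h | h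
        · exact absurd h (Finset.ne_of_mem_erase hw)
        · exact absurd h hwS
      · exact h
    exact le_trans (Finset.card_pos.2 ⟨w, hwC⟩) (humax x hxS)
  obtain ⟨l₁, hl₁, hl₁S, hl₁len⟩ := long_path (K - (G.neighborFinset u ∩ Cy).card) S b u hbS huS
    (by
      intro v hv
      have e1 := Finset.card_le_card (hcover v hv)
      have e2 := Finset.card_union_le (G.neighborFinset v ∩ insert b S) (G.neighborFinset v ∩ Cy)
      have e3 := hdeg v
      have e4 := humax v hv
      rw [← SimpleGraph.card_neighborFinset_eq_degree] at e3
      omega) hcsS hcsS2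
  obtain ⟨l₂, hl₂, hl₂R⟩ := hcsR.path (a := b) (b := g z)
    (Finset.mem_sdiff.2 ⟨hbA, hbS⟩)
    (Finset.mem_sdiff.2 ⟨Finset.mem_insert_self _ _, fun h => hyA (hSA h)⟩)
  obtain ⟨l₃, hl₃, hl₃m, hl₃len⟩ := hl₁.trans hl₂ (by
    intro v hv1 hv2
    rcases Finset.mem_insert.1 (hl₁S v hv1) with h | h
    · exact h
    · exact absurd h (Finset.mem_sdiff.1 (hl₂R v hv2)).2)
  have huz : u ≠ g z := by rintro rfl; exact hyA (hSA huS)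
  obtain ⟨l₀, w, hl₀, hwz, hl₀len, hl₀m⟩ := hl₃.unsnoc huz
  have hl₀A : ∀ v ∈ l₀, v ∈ A := by
    intro v hv
    have hv' : v ∈ insert (g z) A := by
      rcases hl₃m v (hl₀m v hv).1 with h | h
      · rcases Finset.mem_insert.1 (hl₁S v h) with rfl | h
        · exact hbA
        · exact Finset.mem_insert_of_mem (hSA h)
      · exact (Finset.mem_sdiff.1 (hl₂R v h)).1
    exact (Finset.mem_insert.1 hv').resolve_left (hl₀m v hv).2
  have hcard : (G.neighborFinset u ∩ Cy).card ≤
      ((Finset.Ico 1 m).filter (fun D : ℕ => G.Adj u (g (z + (D : ZMod m))))).card := by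
    refine le_trans (Finset.card_le_card ?_)
      (Finset.card_image_le (f := fun D : ℕ => g (z + (D : ZMod m))))
    intro v hv
    rw [Finset.mem_inter, Finset.mem_erase, Finset.mem_image] at hv
    obtain ⟨huv, hvz, i, -, rfl⟩ := hv
    have e : z + (((i - z).val : ℕ) : ZMod m) = i := by
      rw [ZMod.natCast_zmod_val]; ring
    refine Finset.mem_image.2 ⟨(i - z).val, Finset.mem_filter.2 ⟨Finset.mem_Ico.2
      ⟨?_, ZMod.val_lt _⟩, ?_⟩, ?_⟩
    · rw [Nat.one_le_iff_ne_zero]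
      intro h
      rw [ZMod.val_eq_zero, sub_eq_zero] at h
      exact hvz (by rw [h])
    · rw [e]; simpa using huv
    · simp only [e]
  have := ear_bound hinj hadj hmax hno hmK z hl₀ (fun i hi => hAdis _ (hl₀A _ hi) i rfl) hwz
    (Finset.card_pos.1 (by omega))
  omega

end nonham

theorem TwoConnected.cs {V : Type*} [Fintype V] {G : SimpleGraph V} (h : TwoConnected G) (c : V) :
    CS G (Finset.univ.erase c) := by
  intro D hD hne hDT
  obtain ⟨a, ha⟩ := hne
  obtain ⟨b, hb, hbD⟩ : ∃ b ∈ Finset.univ.erase c, b ∉ D := by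
    by_contra hcon
    push Not at hcon
    exact hDT (Finset.Subset.antisymm hD hcon)
  have hac : a ≠ c := Finset.ne_of_mem_erase (hD ha)
  have hbc : b ≠ c := Finset.ne_of_mem_erase hb
  obtain ⟨p⟩ := (h.2 c).preconnected ⟨a, hac⟩ ⟨b, hbc⟩
  obtain ⟨d, -, hd1, hd2⟩ := p.exists_boundary_dart {x | x.1 ∈ D} ha hbD
  refine ⟨d.fst.1, hd1, d.snd.1, ?_, hd2, d.adj⟩
  exact Finset.mem_erase.2 ⟨d.snd.2, Finset.mem_univ _⟩

theorem exists_CL {V : Type*} [Fintype V] {G : SimpleGraph V} (hc : G.Connected)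
    (h3 : 3 ≤ Fintype.card V) (hd : ∀ v, 2 ≤ G.degree v) : ∃ l, CL G l := by
  by_contra hcon
  push Not at hcon
  have hac : G.IsAcyclic := by
    intro v c hcyc
    obtain ⟨l, hl, -⟩ := CL.ofWalk hcyc
    exact hcon l hl
  have ht : G.IsTree := ⟨hc, hac⟩
  have : Nontrivial V := Fintype.one_lt_card_iff_nontrivial.1 (by omega)
  obtain ⟨v, hv⟩ := ht.exists_vert_degree_one_of_nontrivial
  have := hd v
  have e : G.degree v = 1 := by convert hv
  omega

theorem exists_longest {V : Type*} [Fintype V] {G : SimpleGraph V} (h : ∃ l, CL G l) :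
    ∃ l, CL G l ∧ ∀ l', CL G l' → l'.length ≤ l.length := by
  obtain ⟨l₀, hl₀⟩ := h
  have hb : ∀ l, CL G l → l.length ≤ Fintype.card V := by
    rintro l ⟨_, a, b, hp, _⟩
    exact List.Nodup.length_le_card hp.1
  let P : ℕ → Prop := fun n => ∃ l, CL G l ∧ l.length = n
  obtain ⟨l, hl, hlen⟩ : P (Nat.findGreatest P (Fintype.card V)) :=
    Nat.findGreatest_spec (hb l₀ hl₀) ⟨l₀, hl₀, rfl⟩
  refine ⟨l, hl, fun l' hl' => ?_⟩
  rw [hlen]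
  exact Nat.le_findGreatest (hb l' hl') ⟨l', hl', rfl⟩

theorem CS.connected {V : Type*} [Fintype V] {G : SimpleGraph V} (h : CS G Finset.univ)
    [Nonempty V] : G.Connected := by
  refine SimpleGraph.Connected.mk fun a b => ?_
  by_contra hab
  obtain ⟨u, hu, v, -, hv, huv⟩ := h (Finset.univ.filter fun x => G.Reachable a x)
    (Finset.subset_univ _) ⟨a, by simp⟩ (by
      intro he
      have : b ∈ Finset.univ.filter fun x => G.Reachable a x := by rw [he]; simp
      exact hab (by simpa using this))
  have hu' : G.Reachable a u := by simpa using hu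
  exact hv (by simpa using hu'.trans huv.reachable)

theorem TwoConnected.connected {V : Type*} [Fintype V] {G : SimpleGraph V}
    (h : TwoConnected G) (hd : ∀ v, 2 ≤ G.degree v) : G.Connected := by
  have : Nonempty V := Fintype.card_pos_iff.1 (by have := h.1; omega)
  obtain ⟨c⟩ := this
  have : Nonempty V := ⟨c⟩
  apply CS.connected
  apply CS.of_root c
  intro D _ hne hc
  by_cases hD : D = Finset.univ.erase c
  · have h1 := hd c
    rw [← SimpleGraph.card_neighborFinset_eq_degree] at h1
    obtain ⟨v, hv⟩ := Finset.card_pos.1 (show 0 < (G.neighborFinset c).card by omega)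
    have hcv : G.Adj c v := by simpa using hv
    refine ⟨v, ?_, c, by simp, hc, hcv.symm⟩
    rw [hD]; simpa using hcv.ne.symm
  · obtain ⟨u, hu, v, -, hv, huv⟩ := h.cs c D (by
      intro x hx
      simp
      rintro rfl
      exact hc hx) hne hD
    exact ⟨u, hu, v, by simp, hv, huv⟩

/-- Contradiction step: if `G` has `n ≥ 2k+3` vertices (`k ≥ 2`), minimum
degree at least `k+1`, and all its even cycles have length at most `2k`, then
if `G` were 2-connected it would contain an even cycle of length at least
`2k+2`. -/
theorem two_connected_long_even_cycle {V : Type*} [Fintype V] (G : SimpleGraph V)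
    (k : ℕ) (hk : 2 ≤ k) (hn : 2 * k + 3 ≤ Fintype.card V)
    (hδ : k + 1 ≤ G.minDegree)
    (hcyc : ∀ (v : V) (c : G.Walk v v), c.IsCycle → Even c.length → c.length ≤ 2 * k)
    (h2 : TwoConnected G) :
    ∃ (v : V) (c : G.Walk v v), c.IsCycle ∧ Even c.length ∧ 2 * k + 2 ≤ c.length := by
  by_contra hcon
  push Not at hcon
  have hno : ∀ l, CL G l → Even l.length → l.length < 2 * (k + 1) := by
    intro l hl he
    obtain ⟨v, c, hc, hlen⟩ := hl.toWalk
    have := hcyc v c hc (by rw [hlen]; exact he)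
    omega
  have hdeg : ∀ v, k + 1 ≤ G.degree v := fun v => hδ.trans (G.minDegree_le_degree v)
  have hd2 : ∀ v, 2 ≤ G.degree v := fun v => le_trans (by omega) (hdeg v)
  obtain ⟨l, hl, hmax⟩ := exists_longest (exists_CL (h2.connected hd2) h2.1 hd2)
  obtain ⟨g, hinj, hadj, -⟩ := hl.toFun rfl
  have h3 : 3 ≤ l.length := hl.1
  have : NeZero l.length := ⟨by omega⟩
  by_cases hs : Function.Surjective g
  · have hcard := Fintype.card_of_bijective ⟨hinj, hs⟩
    rw [ZMod.card] at hcard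
    rcases Nat.even_or_odd l.length with he | ho
    · have := hno l hl he
      omega
    · exact ham_case (K := k + 1) (by omega) (by omega) ho hinj hs hadj hdeg hno
  · exact nonham_case hinj hadj h3 hdeg h2.cs hmax hno (hno l hl) hs
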